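/- For every natural number n ≥ 2 that is not of the form 3·2^m for any m ≥ 0, there exists a finite tree in which every vertex has degree 1 or 3 and which has exactly n leaves, whose automorphism group has order exactly 2^{k(n)}. -/

import Mathlib

/-- `binOnes n` is the number of 1s in the binary expansion of `n`. -/
def binOnes (n : ℕ) : ℕ := (Nat.digits 2 n).count 1

/-- `kFun n = n - binOnes n`. -/
def kFun (n : ℕ) : ℕ := n - binOnes n

theorem binOnes_two_mul (m : ℕ) : binOnes (2 * m) = binOnes m := by
  rcases Nat.eq_zero_or_pos m with rfl | hm
  · rfl
  · simp [binOnes, Nat.digits_of_two_le_of_pos (b := 2) le_rfl (by omega : 0 < 2 * m)]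

theorem binOnes_two_mul_add_one (m : ℕ) : binOnes (2 * m + 1) = binOnes m + 1 := by
  have h : (2 * m + 1) / 2 = m := by omega
  have h' : (2 * m + 1) % 2 = 1 := by omega
  simp [binOnes, h, h']

theorem binOnes_le (n : ℕ) : binOnes n ≤ n := by
  induction n using Nat.strong_induction_on with
  | _ n ih =>
    rcases Nat.even_or_odd' n with ⟨m, rfl | rfl⟩
    · rcases Nat.eq_zero_or_pos m with rfl | hm
      · simp [binOnes]
      · rw [binOnes_two_mul]
        have := ih m (by omega)
        omega
    · rw [binOnes_two_mul_add_one]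
      have := ih m (by omega)
      omega

theorem kFun_two_mul (m : ℕ) : kFun (2 * m) = m + kFun m := by
  have := binOnes_le m
  rw [kFun, kFun, binOnes_two_mul]
  omega

theorem kFun_two_mul_add_one (m : ℕ) : kFun (2 * m + 1) = m + kFun m := by
  have := binOnes_le m
  rw [kFun, kFun, binOnes_two_mul_add_one]
  omega

namespace SimpleGraph

variable {V : Type} {G : SimpleGraph V} {S : Set V}

/-- The set of vertices of degree one. -/
def leafSet (G : SimpleGraph V) : Set V := {v | (G.neighborSet v).ncard = 1}

theorem Iso.mem_leafSet_iff (φ : G ≃g G) (v : V) : φ v ∈ G.leafSet ↔ v ∈ G.leafSet := by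
  have h : (G.neighborSet (φ v)).ncard = (G.neighborSet v).ncard := by
    rw [← Nat.card_coe_set_eq, ← Nat.card_coe_set_eq]
    exact (Nat.card_congr (φ.mapNeighborSet v)).symm
  simp only [leafSet, Set.mem_ofPred_eq, h]

theorem eq_of_mem_leafSet {u v w : V} (hu : u ∈ G.leafSet) (hv : G.Adj u v) (hw : G.Adj u w) :
    v = w := by
  obtain ⟨a, ha⟩ := Set.ncard_eq_one.1 hu
  have h₁ : v ∈ G.neighborSet u := hv
  have h₂ : w ∈ G.neighborSet u := hw
  rw [ha] at h₁ h₂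
  exact h₁.trans h₂.symm

/-- A connected graph all of whose degrees are 1 or 3, with `n` leaves and `2 * n - 2` vertices. -/
structure IsCubicTree (G : SimpleGraph V) (n : ℕ) : Prop where
  connected : G.Connected
  degree : ∀ v, (G.neighborSet v).ncard = 1 ∨ (G.neighborSet v).ncard = 3
  leaves : G.leafSet.ncard = n
  card : Nat.card V + 2 = 2 * n

theorem IsCubicTree.isTree [Finite V] {n : ℕ} (h : G.IsCubicTree n) : G.IsTree := by
  classical
  have := Fintype.ofFinite V
  rw [isTree_iff_connected_and_card]
  refine ⟨h.connected, ?_⟩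
  have hs := G.sum_degrees_eq_twice_card_edges
  have hd : ∀ v, G.degree v + 2 * (if v ∈ G.leafSet then 1 else 0) = 3 := by
    intro v
    have hv : (G.neighborSet v).ncard = G.degree v := by
      rw [← Nat.card_coe_set_eq, Nat.card_eq_fintype_card, card_neighborSet_eq_degree]
    have hdeg := h.degree v
    have hleaf : v ∈ G.leafSet ↔ (G.neighborSet v).ncard = 1 := Iff.rfl
    split_ifs with hl
    · rw [hleaf, hv] at hl
      rw [hl]
    · rw [hleaf] at hl
      rw [← hv, hdeg.resolve_left hl]
  have hsum : ∑ v, (G.degree v + 2 * (if v ∈ G.leafSet then 1 else 0)) = ∑ _v : V, 3 :=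
    Finset.sum_congr rfl fun v _ => hd v
  have hl : ∑ v, (if v ∈ G.leafSet then 1 else 0) = n := by
    rw [← h.leaves, Set.ncard_eq_toFinset_card', ← Finset.sum_filter]
    simp
  rw [Finset.sum_add_distrib, ← Finset.mul_sum, hl, hs] at hsum
  simp only [Finset.sum_const, Finset.card_univ, smul_eq_mul] at hsum
  have hc := h.card
  rw [Nat.card_eq_fintype_card] at hc ⊢
  rw [Nat.card_eq_fintype_card, ← edgeFinset_card]
  omega

/-- In a connected graph two adjacent leaves are the only vertices. -/
theorem Connected.eq_or_eq_of_adj_leaves (hG : G.Connected) {x t : V} (hx : x ∈ G.leafSet)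
    (ht : t ∈ G.leafSet) (h : G.Adj x t) (v : V) : v = x ∨ v = t := by
  have hr := (reachable_iff_reflTransGen x v).1 (hG.preconnected x v)
  induction hr with
  | refl => exact Or.inl rfl
  | tail _ hadj ih =>
    rcases ih with rfl | rfl
    · exact Or.inr (eq_of_mem_leafSet hx hadj h)
    · exact Or.inl (eq_of_mem_leafSet ht hadj h.symm)

/-- Attach two new pendant vertices to every vertex of `S`. -/
def attachCherries (G : SimpleGraph V) (S : Set V) : SimpleGraph (V ⊕ S × Bool) where
  Adj
    | .inl u, .inl v => G.Adj u v
    | .inl u, .inr s => u = s.1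
    | .inr s, .inl u => u = s.1
    | .inr _, .inr _ => False
  symm := ⟨by
    rintro (u | s) (v | t) h
    · exact Adj.symm h
    · exact h
    · exact h
    · exact h⟩
  loopless := ⟨by
    rintro (u | s) h
    · exact G.loopless.irrefl u h
    · exact h⟩

@[simp] theorem attachCherries_adj_inl_inl {u v : V} :
    (G.attachCherries S).Adj (.inl u) (.inl v) ↔ G.Adj u v := Iff.rfl

@[simp] theorem attachCherries_adj_inl_inr {u : V} {s : S × Bool} :
    (G.attachCherries S).Adj (.inl u) (.inr s) ↔ u = s.1 := Iff.rfl

@[simp] theorem attachCherries_adj_inr_inl {u : V} {s : S × Bool} :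
    (G.attachCherries S).Adj (.inr s) (.inl u) ↔ u = s.1 := Iff.rfl

@[simp] theorem attachCherries_not_adj_inr_inr {s t : S × Bool} :
    ¬ (G.attachCherries S).Adj (.inr s) (.inr t) := id

theorem ncard_neighborSet_attachCherries_inr (s : S × Bool) :
    ((G.attachCherries S).neighborSet (.inr s)).ncard = 1 := by
  rw [Set.ncard_eq_one]
  refine ⟨.inl s.1, ?_⟩
  ext (u | t) <;> simp

theorem ncard_neighborSet_attachCherries_inl_of_notMem {v : V} (hv : v ∉ S) :
    ((G.attachCherries S).neighborSet (.inl v)).ncard = (G.neighborSet v).ncard := by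
  rw [← Set.ncard_image_of_injective (G.neighborSet v) (Sum.inl_injective (β := S × Bool))]
  congr 1
  ext (u | ⟨t, b⟩)
  · simp
  · simp only [mem_neighborSet, attachCherries_adj_inl_inr, Set.mem_image, reduceCtorEq, and_false,
      exists_false, iff_false]
    rintro rfl
    exact hv t.2

theorem ncard_neighborSet_attachCherries_inl_of_mem (hS : S ⊆ G.leafSet) {v : V} (hv : v ∈ S) :
    ((G.attachCherries S).neighborSet (.inl v)).ncard = 3 := by
  obtain ⟨a, ha⟩ := Set.ncard_eq_one.1 (hS hv)
  rw [Set.ncard_eq_three]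
  refine ⟨.inl a, .inr (⟨v, hv⟩, false), .inr (⟨v, hv⟩, true), by simp, by simp, by simp, ?_⟩
  ext (u | ⟨t, b⟩)
  · have : u ∈ G.neighborSet v ↔ u = a := by rw [ha]; rfl
    simpa using this
  · have : v = t ↔ t = ⟨v, hv⟩ := by rw [Subtype.ext_iff, eq_comm]
    cases b <;> simp [this]

theorem inr_mem_leafSet_attachCherries (s : S × Bool) :
    .inr s ∈ (G.attachCherries S).leafSet := ncard_neighborSet_attachCherries_inr s

theorem inl_mem_leafSet_attachCherries (hS : S ⊆ G.leafSet) {v : V} :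
    .inl v ∈ (G.attachCherries S).leafSet ↔ v ∈ G.leafSet \ S := by
  by_cases hv : v ∈ S
  · simp only [leafSet, Set.mem_ofPred_eq, ncard_neighborSet_attachCherries_inl_of_mem hS hv,
      Set.mem_sdiff, hv]
    simp
  · simp only [leafSet, Set.mem_ofPred_eq, ncard_neighborSet_attachCherries_inl_of_notMem hv,
      Set.mem_sdiff, hv]
    simp

theorem IsCubicTree.attachCherries [Finite V] {n : ℕ} (h : G.IsCubicTree n)
    (hS : S ⊆ G.leafSet) : (G.attachCherries S).IsCubicTree (n + S.ncard) where
  connected := by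
    have hl : ∀ u v, (G.attachCherries S).Reachable (.inl u) (.inl v) := fun u v =>
      (h.connected.preconnected u v).map ⟨Sum.inl, fun {_ _} hab => hab⟩
    have hr : ∀ w, ∃ v, (G.attachCherries S).Reachable w (.inl v) := by
      rintro (v | s)
      · exact ⟨v, .rfl⟩
      · exact ⟨s.1, Adj.reachable (by simp)⟩
    have : Nonempty V := h.connected.nonempty
    refine ⟨fun a b => ?_⟩
    obtain ⟨u, hu⟩ := hr a
    obtain ⟨v, hv⟩ := hr b
    exact (hu.trans (hl u v)).trans hv.symm
  degree := by
    rintro (v | s)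
    · by_cases hv : v ∈ S
      · exact Or.inr (ncard_neighborSet_attachCherries_inl_of_mem hS hv)
      · rw [ncard_neighborSet_attachCherries_inl_of_notMem hv]
        exact h.degree v
    · exact Or.inl (ncard_neighborSet_attachCherries_inr s)
  leaves := by
    have hu : (G.attachCherries S).leafSet =
        Sum.inl '' (G.leafSet \ S) ∪ Set.range Sum.inr := by
      ext (v | s)
      · simp [inl_mem_leafSet_attachCherries hS]
      · simp [inr_mem_leafSet_attachCherries]
    rw [hu, Set.ncard_union_eq, Set.ncard_image_of_injective _ Sum.inl_injective,
      ← Set.image_univ, Set.ncard_image_of_injective _ Sum.inr_injective, Set.ncard_univ,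
      Nat.card_prod, Nat.card_coe_set_eq, ← h.leaves, Set.ncard_sdiff hS]
    · have := Set.ncard_le_ncard hS
      simp only [Nat.card_eq_fintype_card, Fintype.card_bool]
      omega
    · rw [Set.disjoint_left]
      rintro _ ⟨v, -, rfl⟩ ⟨s, hs⟩
      cases hs
  card := by
    have := h.card
    rw [Nat.card_sum, Nat.card_prod, Nat.card_coe_set_eq]
    simp only [Nat.card_eq_fintype_card, Fintype.card_bool] at *
    omega

/-- Lift an automorphism preserving `S`, swapping the two new vertices at `s` whenever `f s`. -/
def liftAut (ψ : G ≃g G) (hψ : ∀ v, ψ v ∈ S ↔ v ∈ S) (f : S → Bool) :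
    G.attachCherries S ≃g G.attachCherries S where
  toEquiv := Equiv.sumCongr ψ.toEquiv
    { toFun := fun s => (⟨ψ s.1, (hψ _).2 s.1.2⟩, xor (f s.1) s.2)
      invFun := fun s =>
        (⟨ψ.symm s.1, (hψ _).1 (by simp)⟩,
          xor (f ⟨ψ.symm s.1, (hψ _).1 (by simp)⟩) s.2)
      left_inv := fun s => by ext <;> simp
      right_inv := fun s => by ext <;> simp }
  map_rel_iff' := by
    rintro (u | s) (v | t)
    · exact ψ.map_rel_iff
    · exact ψ.injective.eq_iff
    · exact ψ.injective.eq_iff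
    · exact Iff.rfl

@[simp] theorem liftAut_inl (ψ : G ≃g G) (hψ : ∀ v, ψ v ∈ S ↔ v ∈ S) (f : S → Bool) (v : V) :
    liftAut ψ hψ f (.inl v) = .inl (ψ v) := rfl

@[simp] theorem liftAut_inr (ψ : G ≃g G) (hψ : ∀ v, ψ v ∈ S ↔ v ∈ S) (f : S → Bool)
    (s : S × Bool) :
    liftAut ψ hψ f (.inr s) = .inr (⟨ψ s.1, (hψ _).2 s.1.2⟩, xor (f s.1) s.2) := rfl

theorem liftAut_injective {ψ ψ' : G ≃g G} {hψ : ∀ v, ψ v ∈ S ↔ v ∈ S}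
    {hψ' : ∀ v, ψ' v ∈ S ↔ v ∈ S} {f f' : S → Bool} (h : liftAut ψ hψ f = liftAut ψ' hψ' f') :
    ψ = ψ' ∧ f = f' := by
  constructor
  · ext v
    simpa using DFunLike.congr_fun h (.inl v)
  · funext s
    have := DFunLike.congr_fun h (.inr (s, false))
    simp only [liftAut_inr, Bool.xor_false, Sum.inr.injEq, Prod.mk.injEq] at this
    exact this.2

theorem exists_eq_liftAut [Finite V] (φ : G.attachCherries S ≃g G.attachCherries S)
    (hφ : ∀ v, ∃ u, φ (.inl v) = .inl u) : ∃ ψ hψ f, φ = liftAut ψ hψ f := by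
  have hmem := Equiv.Perm.mem_sumCongrHom_range_of_perm_mapsTo_inl (σ := φ.toEquiv) (by
    rintro _ ⟨v, rfl⟩
    obtain ⟨u, hu⟩ := hφ v
    exact ⟨u, hu.symm⟩)
  obtain ⟨⟨σ, χ⟩, hσ⟩ := hmem
  have hl : ∀ v, φ (.inl v) = .inl (σ v) := fun v => (DFunLike.congr_fun hσ (.inl v)).symm
  have hr : ∀ s, φ (.inr s) = .inr (χ s) := fun s => (DFunLike.congr_fun hσ (.inr s)).symm
  let ψ : G ≃g G := ⟨σ, fun {u v} => by
    simpa [hl] using φ.map_adj_iff (v := .inl u) (w := .inl v)⟩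
  have hχ : ∀ s, σ s.1 = (χ s).1 := fun s => by
    simpa [hl, hr] using φ.map_adj_iff (v := .inl s.1.1) (w := .inr s)
  have hψ : ∀ v, ψ v ∈ S ↔ v ∈ S := fun v => by
    constructor
    · intro hv
      have h := hχ (χ.symm (⟨ψ v, hv⟩, false))
      rw [Equiv.apply_symm_apply] at h
      have := σ.injective h
      rw [← this]
      exact Subtype.coe_prop _
    · intro hv
      have h := hχ (⟨v, hv⟩, false)
      change σ v ∈ S
      rw [h]
      exact Subtype.coe_prop _
  refine ⟨ψ, hψ, fun s => (χ (s, false)).2, ?_⟩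
  ext1 (v | ⟨s, b⟩)
  · exact hl v
  · rw [hr, liftAut_inr]
    congr 1
    refine Prod.ext (Subtype.ext (hχ (s, b)).symm) ?_
    cases b
    · simp
    · have hne : χ (s, true) ≠ χ (s, false) := fun h => by simpa using χ.injective h
      have hfst : (χ (s, true)).1 = (χ (s, false)).1 :=
        Subtype.ext ((hχ (s, true)).symm.trans (hχ (s, false)))
      have hsnd : (χ (s, true)).2 ≠ (χ (s, false)).2 := fun h => hne (Prod.ext hfst h)
      simpa using Bool.eq_not_of_ne hsnd

theorem exists_inl_of_leafSet (hS : S ⊆ G.leafSet)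
    (φ : G.attachCherries S ≃g G.attachCherries S)
    (hφ : ∀ v ∈ G.leafSet \ S, φ (.inl v) = .inl v) (v : V) : ∃ u, φ (.inl v) = .inl u := by
  by_cases hv : v ∈ G.leafSet \ S
  · exact ⟨v, hφ v hv⟩
  · rcases h : φ (.inl v) with u | s
    · exact ⟨u, rfl⟩
    · have := (φ.mem_leafSet_iff (.inl v)).1 (h ▸ inr_mem_leafSet_attachCherries s)
      exact absurd ((inl_mem_leafSet_attachCherries hS).1 this) hv

theorem card_fun_bool [Finite V] : Nat.card (S → Bool) = 2 ^ S.ncard := by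
  rw [Nat.card_fun, Nat.card_eq_fintype_card, Fintype.card_bool, Nat.card_coe_set_eq]

theorem card_fun_bool_apply_eq_false [Finite V] (x : S) :
    2 * Nat.card {f : S → Bool // f x = false} = 2 ^ S.ncard := by
  classical
  rw [← card_fun_bool, ← Nat.card_congr (Equiv.sumCompl fun f : S → Bool => f x = false),
    Nat.card_sum, two_mul]
  congr 1
  refine Nat.card_congr (Equiv.subtypeEquiv
    ((Equiv.refl S).piCongr fun s => if s = x then Equiv.boolNot else Equiv.refl Bool) ?_)
  intro f
  simp [Equiv.piCongr]

theorem card_aut_attachCherries_leafSet [Finite V] :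
    Nat.card (G.attachCherries G.leafSet ≃g G.attachCherries G.leafSet) =
      2 ^ G.leafSet.ncard * Nat.card (G ≃g G) := by
  rw [← card_fun_bool, mul_comm, ← Nat.card_prod]
  refine (Nat.card_congr (Equiv.ofBijective
    (fun p : (G ≃g G) × (G.leafSet → Bool) => liftAut p.1 p.1.mem_leafSet_iff p.2)
    ⟨fun p q h => ?_, fun φ => ?_⟩)).symm
  · obtain ⟨h₁, h₂⟩ := liftAut_injective h
    exact Prod.ext h₁ h₂
  · obtain ⟨ψ, hψ, f, rfl⟩ := exists_eq_liftAut φ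
      (exists_inl_of_leafSet subset_rfl φ (by simp))
    exact ⟨(ψ, f), rfl⟩

theorem card_stabilizer_attachCherries_leafSet [Finite V] {x : V} (hx : x ∈ G.leafSet) :
    2 * Nat.card {φ : G.attachCherries G.leafSet ≃g G.attachCherries G.leafSet //
      φ (.inr (⟨x, hx⟩, false)) = .inr (⟨x, hx⟩, false)} =
      2 ^ G.leafSet.ncard * Nat.card {ψ : G ≃g G // ψ x = x} := by
  rw [← card_fun_bool_apply_eq_false ⟨x, hx⟩, mul_assoc, mul_comm (Nat.card _), ← Nat.card_prod]
  congr 1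
  refine (Nat.card_congr (Equiv.ofBijective
    (fun p : {ψ : G ≃g G // ψ x = x} × {f : G.leafSet → Bool // f ⟨x, hx⟩ = false} =>
      (⟨liftAut p.1.1 p.1.1.mem_leafSet_iff p.2.1, by simp [p.1.2, p.2.2]⟩ :
        {φ : G.attachCherries G.leafSet ≃g G.attachCherries G.leafSet //
          φ (.inr (⟨x, hx⟩, false)) = .inr (⟨x, hx⟩, false)}))
    ⟨fun p q h => ?_, fun ⟨φ, hφ⟩ => ?_⟩)).symm
  · obtain ⟨h₁, h₂⟩ := liftAut_injective (hψ := p.1.1.mem_leafSet_iff)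
      (hψ' := q.1.1.mem_leafSet_iff) (congrArg Subtype.val h)
    exact Prod.ext (Subtype.ext h₁) (Subtype.ext h₂)
  · obtain ⟨ψ, hψ, f, rfl⟩ := exists_eq_liftAut φ
      (exists_inl_of_leafSet subset_rfl φ (by simp))
    simp only [liftAut_inr, Bool.xor_false, Sum.inr.injEq, Prod.mk.injEq, Subtype.mk.injEq] at hφ
    exact ⟨(⟨ψ, hφ.1⟩, ⟨f, hφ.2⟩), rfl⟩

theorem Iso.mem_leafSet_diff_iff {x : V} {ψ : G ≃g G} (h : ψ x = x) (v : V) :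
    ψ v ∈ G.leafSet \ {x} ↔ v ∈ G.leafSet \ {x} := by
  have : ψ v = x ↔ v = x := by
    conv_lhs => rw [← h]
    exact ψ.injective.eq_iff
  simp [ψ.mem_leafSet_iff, this]

theorem card_stabilizer_attachCherries_leafSet_diff [Finite V] (x : V) :
    Nat.card {φ : G.attachCherries (G.leafSet \ {x}) ≃g G.attachCherries (G.leafSet \ {x}) //
      φ (.inl x) = .inl x} =
      2 ^ (G.leafSet \ {x}).ncard * Nat.card {ψ : G ≃g G // ψ x = x} := by
  rw [← card_fun_bool, mul_comm, ← Nat.card_prod]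
  refine (Nat.card_congr (Equiv.ofBijective
    (fun p : {ψ : G ≃g G // ψ x = x} × (↑(G.leafSet \ {x}) → Bool) =>
      (⟨liftAut p.1.1 (Iso.mem_leafSet_diff_iff p.1.2) p.2, by simp [p.1.2]⟩ :
        {φ : G.attachCherries (G.leafSet \ {x}) ≃g G.attachCherries (G.leafSet \ {x}) //
          φ (.inl x) = .inl x}))
    ⟨fun p q h => ?_, fun ⟨φ, hφ⟩ => ?_⟩)).symm
  · obtain ⟨h₁, h₂⟩ := liftAut_injective (hψ := Iso.mem_leafSet_diff_iff p.1.2)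
      (hψ' := Iso.mem_leafSet_diff_iff q.1.2) (congrArg Subtype.val h)
    exact Prod.ext (Subtype.ext h₁) h₂
  · obtain ⟨ψ, hψ, f, rfl⟩ := exists_eq_liftAut φ
      (exists_inl_of_leafSet Set.sdiff_subset φ (by
        rintro v ⟨hv, hv'⟩
        have : v = x := by simpa [hv] using hv'
        rwa [this]))
    exact ⟨(⟨ψ, by simpa using hφ⟩, f), rfl⟩

/-- The leaf `x` is the only one without a sibling leaf, so every automorphism fixes it. -/
theorem attachCherries_leafSet_diff_fixes [Finite V] {x : V} (hG : G.Connected)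
    (hx : x ∈ G.leafSet) (hcard : 3 ≤ G.leafSet.ncard)
    (φ : G.attachCherries (G.leafSet \ {x}) ≃g G.attachCherries (G.leafSet \ {x})) :
    φ (.inl x) = .inl x := by
  have hS : G.leafSet \ {x} ⊆ G.leafSet := Set.sdiff_subset
  have hxl : .inl x ∈ (G.attachCherries (G.leafSet \ {x})).leafSet :=
    (inl_mem_leafSet_attachCherries hS).2 (by simp [hx])
  rcases h : φ (.inl x) with u | ⟨s, b⟩
  · have hu := (inl_mem_leafSet_attachCherries hS).1 (h ▸ (φ.mem_leafSet_iff _).2 hxl)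
    have : u = x := by simpa [hu.1] using hu.2
    rw [this]
  · exfalso
    have hadj : (G.attachCherries (G.leafSet \ {x})).Adj (.inl x) (φ.symm (.inl s)) := by
      rw [← φ.map_adj_iff, h]
      simp
    rcases hy : φ.symm (.inr (s, !b)) with y | ⟨t, c⟩
    · have hyl : .inl y ∈ (G.attachCherries (G.leafSet \ {x})).leafSet :=
        hy ▸ (φ.symm.mem_leafSet_iff _).2 (inr_mem_leafSet_attachCherries _)
      have hy' := (inl_mem_leafSet_attachCherries hS).1 hyl
      have hyx : y = x := by simpa [hy'.1] using hy'.2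
      rw [hyx, RelIso.symm_apply_eq, h] at hy
      simp at hy
    · have hadj' : (G.attachCherries (G.leafSet \ {x})).Adj (.inr (t, c)) (φ.symm (.inl s)) := by
        rw [← hy, φ.symm.map_adj_iff]
        simp
      rcases hc : φ.symm (.inl s) with w | r
      · rw [hc] at hadj hadj'
        simp only [attachCherries_adj_inl_inl, attachCherries_adj_inr_inl] at hadj hadj'
        subst hadj'
        have hsub : G.leafSet ⊆ {x, t.1} := fun v _ =>
          hG.eq_or_eq_of_adj_leaves hx t.2.1 hadj v
        have := Set.ncard_le_ncard hsub
        have := Set.ncard_insert_le x {t.1}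
        rw [Set.ncard_singleton] at this
        omega
      · rw [hc] at hadj'
        simp at hadj'

theorem isCubicTree_top_bool : (⊤ : SimpleGraph Bool).IsCubicTree 2 := by
  have hn : ∀ v, ((⊤ : SimpleGraph Bool).neighborSet v).ncard = 1 := fun v => by
    rw [Set.ncard_eq_one]
    refine ⟨!v, ?_⟩
    ext u
    cases u <;> cases v <;> simp
  refine ⟨connected_top, fun v => Or.inl (hn v), ?_, by simp⟩
  have : (⊤ : SimpleGraph Bool).leafSet = Set.univ := Set.eq_univ_of_forall hn
  rw [this, Set.ncard_univ]
  simp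

theorem card_aut_top_bool : Nat.card ((⊤ : SimpleGraph Bool) ≃g (⊤ : SimpleGraph Bool)) = 2 := by
  have h : Nat.card (Equiv.Perm Bool) = 2 := by
    rw [Nat.card_perm]
    simp
  rw [← h]
  exact Nat.card_congr ⟨RelIso.toEquiv, Iso.completeGraph, fun _ => rfl, fun _ => rfl⟩

theorem card_stabilizer_top_bool :
    Nat.card {φ : (⊤ : SimpleGraph Bool) ≃g (⊤ : SimpleGraph Bool) // φ false = false} = 1 := by
  rw [Nat.card_eq_one_iff_unique]
  refine ⟨⟨fun ⟨φ, hφ⟩ ⟨ψ, hψ⟩ => ?_⟩, ⟨⟨RelIso.refl _, rfl⟩⟩⟩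
  have key : ∀ χ : (⊤ : SimpleGraph Bool) ≃g (⊤ : SimpleGraph Bool), χ false = false →
      χ true = true := fun χ h => by
    have := χ.injective.ne (show true ≠ false by simp)
    rw [h] at this
    simpa using this
  refine Subtype.ext (RelIso.ext fun b => ?_)
  cases b
  · exact hφ.trans hψ.symm
  · exact (key φ hφ).trans (key ψ hψ).symm

/-- Planted trees: one of the `n + 1` leaves is distinguished. -/
theorem exists_isCubicTree_card_stabilizer (n : ℕ) (hn : 1 ≤ n) :
    ∃ (V : Type) (_ : Finite V) (G : SimpleGraph V) (x : V), G.IsCubicTree (n + 1) ∧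
      x ∈ G.leafSet ∧ Nat.card {φ : G ≃g G // φ x = x} = 2 ^ kFun n := by
  induction n using Nat.strong_induction_on with
  | _ n ih =>
    rcases Nat.even_or_odd' n with ⟨m, rfl | rfl⟩
    · obtain ⟨V, _, G, x, hG, hx, hc⟩ := ih m (by omega) (by omega)
      have hm : (G.leafSet \ {x}).ncard = m := by
        rw [Set.ncard_sdiff_singleton_of_mem hx, hG.leaves, Nat.add_sub_cancel]
      refine ⟨_, inferInstance, G.attachCherries (G.leafSet \ {x}), .inl x, ?_, ?_, ?_⟩
      · convert hG.attachCherries (S := G.leafSet \ {x}) Set.sdiff_subset using 1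
        omega
      · exact (inl_mem_leafSet_attachCherries Set.sdiff_subset).2 (by simp [hx])
      · rw [card_stabilizer_attachCherries_leafSet_diff, hm, hc, kFun_two_mul, pow_add]
    · rcases Nat.eq_zero_or_pos m with rfl | hm
      · refine ⟨Bool, inferInstance, ⊤, false, isCubicTree_top_bool, ?_, ?_⟩
        · obtain ⟨a, ha⟩ := Set.nonempty_of_ncard_ne_zero
            (isCubicTree_top_bool.leaves.trans_ne two_ne_zero)
          cases a
          · exact ha
          · exact (Iso.mem_leafSet_iff (Iso.completeGraph Equiv.boolNot) false).1 ha
        · rw [card_stabilizer_top_bool]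
          simp [kFun, binOnes]
      · obtain ⟨V, _, G, x, hG, hx, hc⟩ := ih m (by omega) (by omega)
        refine ⟨_, inferInstance, G.attachCherries G.leafSet, .inr (⟨x, hx⟩, false), ?_,
          inr_mem_leafSet_attachCherries _, ?_⟩
        · convert hG.attachCherries subset_rfl using 1
          rw [hG.leaves]
          omega
        · have := card_stabilizer_attachCherries_leafSet hx
          rw [hc, hG.leaves, pow_succ, mul_comm (2 ^ m), mul_assoc] at this
          rw [Nat.eq_of_mul_eq_mul_left Nat.two_pos this, kFun_two_mul_add_one, pow_add]

theorem exists_isCubicTree_card_aut (n : ℕ) (hn : 2 ≤ n) (hnot : ¬ ∃ m : ℕ, n = 3 * 2 ^ m) :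
    ∃ (V : Type) (_ : Finite V) (G : SimpleGraph V), G.IsCubicTree n ∧
      Nat.card (G ≃g G) = 2 ^ kFun n := by
  induction n using Nat.strong_induction_on with
  | _ n ih =>
    rcases Nat.even_or_odd' n with ⟨m, rfl | rfl⟩
    · rcases (by omega : m = 1 ∨ 2 ≤ m) with rfl | hm
      · refine ⟨Bool, inferInstance, ⊤, isCubicTree_top_bool, ?_⟩
        rw [card_aut_top_bool]
        simp [kFun, binOnes]
      · obtain ⟨V, _, G, hG, hc⟩ := ih m (by omega) hm fun ⟨j, hj⟩ =>
          hnot ⟨j + 1, by rw [hj]; ring⟩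
        refine ⟨_, inferInstance, G.attachCherries G.leafSet, ?_, ?_⟩
        · convert hG.attachCherries subset_rfl using 1
          rw [hG.leaves]
          omega
        · rw [card_aut_attachCherries_leafSet, hc, hG.leaves, kFun_two_mul, pow_add]
    · have hm : 2 ≤ m := by
        by_contra h
        exact hnot ⟨0, by omega⟩
      obtain ⟨V, _, G, x, hG, hx, hc⟩ := exists_isCubicTree_card_stabilizer m (by omega)
      have hm' : (G.leafSet \ {x}).ncard = m := by
        rw [Set.ncard_sdiff_singleton_of_mem hx, hG.leaves, Nat.add_sub_cancel]
      refine ⟨_, inferInstance, G.attachCherries (G.leafSet \ {x}), ?_, ?_⟩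
      · convert hG.attachCherries (S := G.leafSet \ {x}) Set.sdiff_subset using 1
        omega
      · have hfix := attachCherries_leafSet_diff_fixes hG.connected hx
          (by rw [hG.leaves]; omega)
        rw [← Nat.card_congr (Equiv.subtypeUnivEquiv hfix),
          card_stabilizer_attachCherries_leafSet_diff, hm', hc, kFun_two_mul_add_one, pow_add]

end SimpleGraph

theorem exists_tree_aut_card (n : ℕ) (hn : 2 ≤ n)
    (hnot : ¬ ∃ m : ℕ, n = 3 * 2 ^ m) :
    ∃ (V : Type) (_ : Fintype V) (G : SimpleGraph V),
      G.IsTree ∧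
      (∀ v : V, (G.neighborSet v).ncard = 1 ∨ (G.neighborSet v).ncard = 3) ∧
      {v : V | (G.neighborSet v).ncard = 1}.ncard = n ∧
      Nat.card (G ≃g G) = 2 ^ kFun n := by
  obtain ⟨V, _, G, hG, hc⟩ := SimpleGraph.exists_isCubicTree_card_aut n hn hnot
  exact ⟨V, Fintype.ofFinite V, G, hG.isTree, hG.degree, hG.leaves, hc⟩
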